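/- Fix α ∈ (0, 1/2). The function G is strictly decreasing on [0, ∞); moreover G(y) > Φ⁻¹(1 − α) for every y ≥ 0, and G(y) → Φ⁻¹(1 − α) as y → ∞, where Φ⁻¹(1 − α) denotes the unique real q with Φ(q) = 1 − α. -/

import Mathlib

open MeasureTheory ProbabilityTheory Filter

/-- The standard normal cumulative distribution function. -/
noncomputable def Phi (x : ℝ) : ℝ := (gaussianReal 0 1 (Set.Iic x)).toReal

/-- `Phi` is Mathlib's `cdf` of the standard Gaussian measure. -/
theorem Phi_eq_cdf (x : ℝ) : Phi x = cdf (gaussianReal 0 1) x :=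
  (cdf_eq_real (gaussianReal 0 1) x).symm

theorem Phi_le_one (x : ℝ) : Phi x ≤ 1 := by
  rw [Phi_eq_cdf]
  exact cdf_le_one _ x

theorem tendsto_Phi_atTop : Tendsto Phi atTop (nhds 1) := by
  rw [funext Phi_eq_cdf]
  exact tendsto_cdf_atTop _

theorem strictMono_Phi : StrictMono Phi := by
  intro a b hab
  have hpos : 0 < (gaussianReal 0 1).real (Set.Ioc a b) := by
    refine ENNReal.toReal_pos (fun h => ?_) (measure_ne_top _ _)
    have h' := gaussianReal_absolutelyContinuous' 0 one_ne_zero h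
    rw [Real.volume_Ioc, ENNReal.ofReal_eq_zero] at h'
    linarith
  have hadd : (gaussianReal 0 1).real (Set.Iic a ∪ Set.Ioc a b) =
      (gaussianReal 0 1).real (Set.Iic a) + (gaussianReal 0 1).real (Set.Ioc a b) :=
    measureReal_union (Set.Iic_disjoint_Ioc le_rfl) measurableSet_Ioc
  rw [Set.Iic_union_Ioc_eq_Iic hab.le] at hadd
  change (gaussianReal 0 1).real (Set.Iic a) < (gaussianReal 0 1).real (Set.Iic b)
  linarith

theorem Phi_lt_one (x : ℝ) : Phi x < 1 :=
  (strictMono_Phi (lt_add_one x)).trans_le (Phi_le_one _)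

theorem Phi_neg (x : ℝ) : Phi (-x) = 1 - Phi x := by
  have : NullSingletonClass (gaussianReal 0 1) := nullSingletonClass_gaussianReal one_ne_zero
  have hmap : (gaussianReal 0 1) (Set.Iic (-x)) = (gaussianReal 0 1) (Set.Ioi x) := by
    have h := gaussianReal_map_neg (μ := 0) (v := 1)
    rw [neg_zero] at h
    conv_lhs => rw [← h]
    rw [Measure.map_apply measurable_neg measurableSet_Iic, measure_congr Ioi_ae_eq_Ici]
    congr 1
    ext z
    simp
  have hcompl := probReal_compl_eq_one_sub (μ := gaussianReal 0 1) (measurableSet_Iic (a := x))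
  rw [Set.compl_Iic] at hcompl
  rw [Phi, hmap]
  exact hcompl

/-- For fixed `α ∈ (0, 1/2)`, the function `G` (assigning to each `y ≥ 0`
the unique `c > 0` with `Φ(c + y) − Φ(−c) = 1 − α`) is strictly decreasing on `[0, ∞)`;
moreover `G(y) > Φ⁻¹(1 − α)` for every `y ≥ 0` and `G(y) → Φ⁻¹(1 − α)` as `y → ∞`,
where `Φ⁻¹(1 − α)` is the unique real `q` with `Φ(q) = 1 − α`. -/
theorem critical_value_strictAnti_and_limit
    (α : ℝ) (hα : 0 < α) (hα' : α < 1 / 2)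
    (G : ℝ → ℝ)
    (hG : ∀ y : ℝ, 0 ≤ y → 0 < G y ∧ Phi (G y + y) - Phi (-(G y)) = 1 - α)
    (q : ℝ) (hq : Phi q = 1 - α) :
    StrictAntiOn G (Set.Ici (0 : ℝ)) ∧
      (∀ y : ℝ, 0 ≤ y → q < G y) ∧
      Tendsto G atTop (nhds q) := by
  have hlower : ∀ y : ℝ, 0 ≤ y → q < G y := by
    intro y hy
    have heq := (hG y hy).2
    rw [Phi_neg] at heq
    exact strictMono_Phi.lt_iff_lt.1 (by linarith [Phi_lt_one (G y + y)])
  refine ⟨?_, ?_, ?_⟩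
  · intro y₁ h₁ y₂ h₂ hlt
    by_contra! hle
    have hupper := strictMono_Phi (add_lt_add_of_le_of_lt hle hlt)
    have hlower := strictMono_Phi.monotone (neg_le_neg hle)
    linarith [(hG y₁ h₁).2, (hG y₂ h₂).2]
  · exact hlower
  · refine tendsto_order.2 ⟨fun a ha => ?_, fun b hb => ?_⟩
    · filter_upwards [eventually_ge_atTop 0] with y hy
      exact ha.trans (hlower y hy)
    · have hPhib : 2 - α - Phi b < 1 := by linarith [strictMono_Phi hb]
      filter_upwards [eventually_ge_atTop 0, tendsto_Phi_atTop.eventually_const_lt hPhib]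
        with y hy hy'
      obtain ⟨hpos, heq⟩ := hG y hy
      have hmono := strictMono_Phi.monotone (show y ≤ G y + y by linarith)
      rw [Phi_neg] at heq
      exact strictMono_Phi.lt_iff_lt.1 (by linarith)
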